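/- Let X be an ℝⁿ-valued standard Gaussian random vector with law N(0, I_n) and let A ∈ ℝ^{n×n} be any matrix. Then E[XᵀAX] = Tr(A), and for every t > 0, P(XᵀAX − Tr(A) ≥ t) ≤ exp{ −min( t²/(8‖A‖_F²), t/(8‖A‖₂) ) }. -/

import Mathlib

open Matrix MeasureTheory ProbabilityTheory

/-- A measure `μ` on `ℝ^d` is the Gaussian distribution `N(m, S)` iff every linear
functional pushes it to the corresponding one-dimensional Gaussian (Cramér–Wold). -/
def IsGaussianLaw {d : Type*} [Fintype d] (μ : Measure (d → ℝ))
    (m : d → ℝ) (S : Matrix d d ℝ) : Prop :=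
  ∀ a : d → ℝ, μ.map (fun x => a ⬝ᵥ x) =
    gaussianReal (a ⬝ᵥ m) (Real.toNNReal (a ⬝ᵥ S *ᵥ a))

/-- The Frobenius norm of a real matrix. -/
noncomputable def frobNorm {ι : Type*} [Fintype ι] (M : Matrix ι ι ℝ) : ℝ :=
  Real.sqrt (∑ i, ∑ j, (M i j) ^ 2)

/-- The operator (spectral) 2-norm of a real matrix. -/
noncomputable def specNorm {ι : Type*} [Fintype ι] [DecidableEq ι] (M : Matrix ι ι ℝ) : ℝ :=
  ‖Matrix.toEuclideanCLM (𝕜 := ℝ) M‖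

lemma exp_neg_sub_sq_le_one_sub {x : ℝ} (hx : |x| ≤ 1 / 2) :
    Real.exp (-x - x ^ 2) ≤ 1 - x := by
  have hpos : 0 < 1 - x := by linarith [le_abs_self x]
  rw [← Real.le_log_iff_exp_le hpos]
  have h := neg_le_of_abs_le (Real.abs_log_sub_add_sum_range_le (lt_of_le_of_lt hx (by norm_num)) 4)
  have hden : |x| ^ 5 / (1 - |x|) ≤ x ^ 2 / 4 := by
    rw [div_le_iff₀ (by linarith)]
    have h3 : |x| ^ 3 ≤ (1 / 2) ^ 3 := pow_le_pow_left₀ (abs_nonneg x) hx 3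
    have h5 : |x| ^ 5 = x ^ 2 * |x| ^ 3 := by rw [← sq_abs x]; ring
    rw [h5]
    nlinarith [sq_nonneg x]
  norm_num [Finset.sum_range_succ] at h
  obtain ⟨h1, h2⟩ := abs_le.mp hx
  nlinarith [sq_nonneg x, mul_nonneg (sq_nonneg x) (sub_nonneg.2 h2),
    mul_nonneg (sq_nonneg x) (mul_nonneg (sub_nonneg.2 h2) (by linarith : 0 ≤ x + 1 / 2))]

lemma integral_exp_mul_sq_gaussianReal (b : ℝ) :
    ∫ x, Real.exp (b * x ^ 2) ∂gaussianReal 0 1 = (√(1 - 2 * b))⁻¹ := by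
  rw [integral_gaussianReal_eq_integral_smul (by simp)]
  have : ∀ x : ℝ, gaussianPDFReal 0 1 x • Real.exp (b * x ^ 2)
      = (√(2 * Real.pi))⁻¹ * Real.exp (-(1 / 2 - b) * x ^ 2) := fun x ↦ by
    simp only [gaussianPDFReal, NNReal.coe_one, mul_one, sub_zero, smul_eq_mul]
    rw [mul_assoc, ← Real.exp_add]
    ring_nf
  simp_rw [this]
  rw [integral_const_mul, integral_gaussian, ← Real.sqrt_inv, ← Real.sqrt_inv,
    ← Real.sqrt_mul (by positivity)]
  congr 1
  rw [show 1 - 2 * b = 2 * (1 / 2 - b) by ring, mul_inv, mul_inv]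
  field_simp

lemma integral_exp_mul_sq_sub_one_gaussianReal (u : ℝ) :
    ∫ x, Real.exp (u * (x ^ 2 - 1)) ∂gaussianReal 0 1
      = Real.exp (-u) * (√(1 - 2 * u))⁻¹ := by
  rw [← integral_exp_mul_sq_gaussianReal, ← integral_const_mul]
  congr with x
  rw [← Real.exp_add]
  ring_nf

lemma integrable_exp_mul_sq_sub_one_gaussianReal {u : ℝ} (hu : |u| ≤ 1 / 4) :
    Integrable (fun x ↦ Real.exp (u * (x ^ 2 - 1))) (gaussianReal 0 1) := by
  have hpos : 0 < 1 - 2 * u := by linarith [le_abs_self u]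
  refine .of_integral_ne_zero ?_
  rw [integral_exp_mul_sq_sub_one_gaussianReal]
  positivity

lemma integral_exp_mul_sq_sub_one_gaussianReal_le {u : ℝ} (hu : |u| ≤ 1 / 4) :
    ∫ x, Real.exp (u * (x ^ 2 - 1)) ∂gaussianReal 0 1 ≤ Real.exp (2 * u ^ 2) := by
  have hpos : 0 < 1 - 2 * u := by linarith [le_abs_self u]
  rw [integral_exp_mul_sq_sub_one_gaussianReal, ← div_eq_mul_inv,
    div_le_iff₀ (Real.sqrt_pos.2 hpos), ← div_le_iff₀' (Real.exp_pos _), ← Real.exp_sub]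
  refine Real.le_sqrt_of_sq_le ?_
  rw [← Real.exp_nat_mul]
  convert! exp_neg_sub_sq_le_one_sub (x := 2 * u)
    (by rw [abs_mul, abs_of_pos two_pos]; linarith) using 2
  push_cast
  ring

lemma integral_sq_gaussianReal : ∫ x, x ^ 2 ∂gaussianReal 0 1 = 1 := by
  have h := variance_fun_id_gaussianReal (μ := 0) (v := 1)
  rw [variance_of_integral_eq_zero (by fun_prop) (by simp)] at h
  simpa using h

lemma integrable_sq_gaussianReal : Integrable (fun x ↦ x ^ 2) (gaussianReal 0 1) :=
  .of_integral_ne_zero (by simp [integral_sq_gaussianReal])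

/-- A random vector with law `N(0, I)` has i.i.d. standard Gaussian coordinates in every
orthonormal basis. -/
lemma IsGaussianLaw.map_repr_eq_pi {ι : Type*} [Fintype ι] [DecidableEq ι] {μ : Measure (ι → ℝ)}
    [IsProbabilityMeasure μ] (hμ : IsGaussianLaw μ 0 1)
    (b : OrthonormalBasis ι ℝ (EuclideanSpace ℝ ι)) :
    μ.map (fun x ↦ (b.repr (WithLp.toLp 2 x)).ofLp) = Measure.pi fun _ ↦ gaussianReal 0 1 := by
  have hstd : μ.map (WithLp.toLp 2) = stdGaussian (EuclideanSpace ℝ ι) := by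
    refine Measure.ext_of_charFun (funext fun a ↦ ?_)
    rw [charFun_stdGaussian, charFun_apply, integral_map (by fun_prop) (by fun_prop)]
    have h := congrArg (charFun · 1) (hμ a.ofLp)
    simp only [charFun_gaussianReal] at h
    rw [charFun_apply_real, integral_map (by fun_prop) (by fun_prop)] at h
    have hnorm : a.ofLp ⬝ᵥ a.ofLp = ‖a‖ ^ 2 := by
      rw [EuclideanSpace.real_norm_sq_eq]
      simp [dotProduct, sq]
    simp only [EuclideanSpace.inner_eq_star_dotProduct, star_trivial]
    simp [hnorm] at h
    rw [h]
    ring_nf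
  have hrepr : (μ.map (WithLp.toLp 2)).map b.repr
      = (Measure.pi fun _ : ι ↦ gaussianReal 0 1).map (WithLp.toLp 2) := by
    rw [hstd, stdGaussian_map, map_pi_eq_stdGaussian]
  have h := congrArg (Measure.map WithLp.ofLp) hrepr
  rw [Measure.map_map (by fun_prop) (by fun_prop), Measure.map_map (by fun_prop) (by fun_prop),
    Measure.map_map (by fun_prop) (by fun_prop)] at h
  simpa [Function.comp_def] using h

/-- A real quadratic form is diagonal in some orthonormal basis. -/
lemma exists_orthonormalBasis_dotProduct_mulVec_eq {ι : Type*} [Fintype ι] [DecidableEq ι]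
    (A : Matrix ι ι ℝ) :
    ∃ (b : OrthonormalBasis ι ℝ (EuclideanSpace ℝ ι)) (l : ι → ℝ), ∑ i, l i = A.trace ∧
      ∀ x : ι → ℝ, x ⬝ᵥ A *ᵥ x = ∑ i, l i * (b.repr (WithLp.toLp 2 x) i) ^ 2 := by
  let S : Matrix ι ι ℝ := (1 / 2 : ℝ) • (A + Aᵀ)
  have hS : S.IsHermitian := by
    simp [S, Matrix.IsHermitian, Matrix.conjTranspose_eq_transpose_of_trivial, add_comm]
  refine ⟨hS.eigenvectorBasis, hS.eigenvalues, ?_, fun x ↦ ?_⟩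
  · have h := hS.trace_eq_sum_eigenvalues
    simp only [RCLike.ofReal_real_eq_id, id] at h
    rw [← h]
    simp [S]
    ring
  · have hAS : x ⬝ᵥ A *ᵥ x = x ⬝ᵥ S *ᵥ x := by
      have : x ⬝ᵥ Aᵀ *ᵥ x = x ⬝ᵥ A *ᵥ x := by
        rw [Matrix.mulVec_transpose, dotProduct_comm, Matrix.dotProduct_mulVec]
      simp [S, Matrix.smul_mulVec, Matrix.add_mulVec, this]
      ring
    rw [hAS, ← Matrix.inner_toEuclideanCLM S (WithLp.toLp 2 x) (WithLp.toLp 2 x),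
      ← hS.eigenvectorBasis.sum_inner_mul_inner]
    refine Finset.sum_congr rfl fun i _ ↦ ?_
    have hsymm : inner ℝ (hS.eigenvectorBasis i)
        (Matrix.toEuclideanCLM (𝕜 := ℝ) S (WithLp.toLp 2 x))
        = hS.eigenvalues i * inner ℝ (hS.eigenvectorBasis i) (WithLp.toLp 2 x) := by
      rw [Matrix.inner_toEuclideanCLM, Matrix.dotProduct_mulVec, ← Matrix.mulVec_transpose,
        ← Matrix.conjTranspose_eq_transpose_of_trivial, hS.eq, hS.mulVec_eigenvectorBasis,
        smul_dotProduct, real_inner_comm, EuclideanSpace.inner_eq_star_dotProduct]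
      simp [dotProduct_comm]
    rw [hsymm, OrthonormalBasis.repr_apply_apply, real_inner_comm]
    ring

section QuadraticFormBounds

variable {ι : Type*} [Fintype ι] [DecidableEq ι] {A : Matrix ι ι ℝ}
  {b : OrthonormalBasis ι ℝ (EuclideanSpace ℝ ι)} {l : ι → ℝ}

lemma inner_toEuclideanCLM_eq_of_diagonal
    (hA : ∀ x : ι → ℝ, x ⬝ᵥ A *ᵥ x = ∑ i, l i * (b.repr (WithLp.toLp 2 x) i) ^ 2) (i : ι) :
    inner ℝ (b i) (Matrix.toEuclideanCLM (𝕜 := ℝ) A (b i)) = l i := by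
  rw [Matrix.inner_toEuclideanCLM, hA]
  simp

lemma abs_le_norm_toEuclideanCLM_apply_of_diagonal
    (hA : ∀ x : ι → ℝ, x ⬝ᵥ A *ᵥ x = ∑ i, l i * (b.repr (WithLp.toLp 2 x) i) ^ 2) (i : ι) :
    |l i| ≤ ‖Matrix.toEuclideanCLM (𝕜 := ℝ) A (b i)‖ := by
  rw [← inner_toEuclideanCLM_eq_of_diagonal hA i]
  simpa using abs_real_inner_le_norm (b i) (Matrix.toEuclideanCLM (𝕜 := ℝ) A (b i))

lemma abs_le_specNorm_of_diagonal
    (hA : ∀ x : ι → ℝ, x ⬝ᵥ A *ᵥ x = ∑ i, l i * (b.repr (WithLp.toLp 2 x) i) ^ 2) (i : ι) :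
    |l i| ≤ specNorm A := by
  refine (abs_le_norm_toEuclideanCLM_apply_of_diagonal hA i).trans ?_
  simpa [specNorm] using (Matrix.toEuclideanCLM (𝕜 := ℝ) A).le_opNorm (b i)

lemma sum_sq_norm_toEuclideanCLM_apply (A : Matrix ι ι ℝ)
    (b : OrthonormalBasis ι ℝ (EuclideanSpace ℝ ι)) :
    ∑ i, ‖Matrix.toEuclideanCLM (𝕜 := ℝ) A (b i)‖ ^ 2 = frobNorm A ^ 2 := by
  rw [frobNorm, Real.sq_sqrt (by positivity)]
  simp_rw [EuclideanSpace.real_norm_sq_eq]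
  rw [Finset.sum_comm]
  refine Finset.sum_congr rfl fun j _ ↦ ?_
  have h := b.sum_sq_inner_right (WithLp.toLp 2 (A j))
  rw [EuclideanSpace.real_norm_sq_eq] at h
  rw [← h]
  refine Finset.sum_congr rfl fun i _ ↦ ?_
  simp [EuclideanSpace.inner_eq_star_dotProduct, Matrix.mulVec]

lemma sum_sq_le_frobNorm_sq_of_diagonal
    (hA : ∀ x : ι → ℝ, x ⬝ᵥ A *ᵥ x = ∑ i, l i * (b.repr (WithLp.toLp 2 x) i) ^ 2) :
    ∑ i, l i ^ 2 ≤ frobNorm A ^ 2 := by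
  rw [← sum_sq_norm_toEuclideanCLM_apply A b]
  refine Finset.sum_le_sum fun i _ ↦ ?_
  rw [← sq_abs]
  gcongr
  exact abs_le_norm_toEuclideanCLM_apply_of_diagonal hA i

end QuadraticFormBounds

section Chernoff

variable {ι : Type*} [Fintype ι] {l : ι → ℝ} {s : ℝ}

lemma exp_mul_sum_mul_sq_sub_one (y : ι → ℝ) :
    Real.exp (s * ∑ i, l i * (y i ^ 2 - 1)) = ∏ i, Real.exp (s * l i * (y i ^ 2 - 1)) := by
  rw [← Real.exp_sum, Finset.mul_sum]
  simp_rw [mul_assoc]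

lemma integrable_exp_mul_sum_mul_sq_sub_one (hs : ∀ i, |s * l i| ≤ 1 / 4) :
    Integrable (fun y : ι → ℝ ↦ Real.exp (s * ∑ i, l i * (y i ^ 2 - 1)))
      (Measure.pi fun _ ↦ gaussianReal 0 1) := by
  simp_rw [exp_mul_sum_mul_sq_sub_one]
  exact Integrable.fintype_prod (f := fun i x ↦ Real.exp (s * l i * (x ^ 2 - 1)))
    fun i ↦ integrable_exp_mul_sq_sub_one_gaussianReal (hs i)

lemma mgf_sum_mul_sq_sub_one_le (hs : ∀ i, |s * l i| ≤ 1 / 4) :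
    mgf (fun y : ι → ℝ ↦ ∑ i, l i * (y i ^ 2 - 1)) (Measure.pi fun _ ↦ gaussianReal 0 1) s
      ≤ Real.exp (2 * s ^ 2 * ∑ i, l i ^ 2) := by
  simp_rw [mgf, exp_mul_sum_mul_sq_sub_one]
  rw [integral_fintype_prod_eq_prod (fun i x ↦ Real.exp (s * l i * (x ^ 2 - 1))),
    Finset.mul_sum, Real.exp_sum]
  refine Finset.prod_le_prod (fun i _ ↦ integral_nonneg fun _ ↦ (Real.exp_pos _).le) fun i _ ↦ ?_
  refine (integral_exp_mul_sq_sub_one_gaussianReal_le (hs i)).trans_eq ?_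
  ring_nf

/-- Bernstein-type tail bound for weighted sums of independent centred `χ²` variables. -/
lemma measureReal_pi_gaussianReal_le_sum_mul_sq_sub_one {F L t : ℝ} (hF : 0 < F) (hL : 0 < L)
    (ht : 0 < t) (hlF : ∑ i, l i ^ 2 ≤ F ^ 2) (hlL : ∀ i, |l i| ≤ L) :
    (Measure.pi fun _ : ι ↦ gaussianReal 0 1).real {y | t ≤ ∑ i, l i * (y i ^ 2 - 1)}
      ≤ Real.exp (-(min (t ^ 2 / (8 * F ^ 2)) (t / (8 * L)))) := by
  set s := min (t / (4 * F ^ 2)) (1 / (4 * L)) with hsdef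
  have hs0 : 0 < s := lt_min (by positivity) (by positivity)
  have hsF : s * (4 * F ^ 2) ≤ t := (le_div_iff₀ (by positivity)).1 (min_le_left _ _)
  have hsL : s * (4 * L) ≤ 1 := (le_div_iff₀ (by positivity)).1 (min_le_right _ _)
  have hsl : ∀ i, |s * l i| ≤ 1 / 4 := fun i ↦ by
    rw [abs_mul, abs_of_pos hs0]
    nlinarith [mul_le_mul_of_nonneg_left (hlL i) hs0.le]
  have hexp : min (t ^ 2 / (8 * F ^ 2)) (t / (8 * L)) = s * t / 2 := by
    rw [mul_div_assoc, hsdef, min_mul_of_nonneg _ _ (by positivity)]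
    congr 1 <;> field_simp <;> norm_num
  refine (measure_ge_le_exp_mul_mgf t hs0.le (integrable_exp_mul_sum_mul_sq_sub_one hsl)).trans ?_
  refine (mul_le_mul_of_nonneg_left (mgf_sum_mul_sq_sub_one_le hsl) (Real.exp_pos _).le).trans ?_
  rw [← Real.exp_add, hexp, Real.exp_le_exp]
  nlinarith [mul_le_mul_of_nonneg_left hlF (sq_nonneg s), mul_le_mul_of_nonneg_left hsF hs0.le]

end Chernoff

lemma frobNorm_eq_zero_iff {ι : Type*} [Fintype ι] {A : Matrix ι ι ℝ} :
    frobNorm A = 0 ↔ A = 0 := by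
  rw [frobNorm, Real.sqrt_eq_zero (by positivity),
    Finset.sum_eq_zero_iff_of_nonneg fun i _ ↦ by positivity]
  simp [Finset.sum_eq_zero_iff_of_nonneg, sq_nonneg, ← Matrix.ext_iff]

lemma specNorm_eq_zero_iff {ι : Type*} [Fintype ι] [DecidableEq ι] {A : Matrix ι ι ℝ} :
    specNorm A = 0 ↔ A = 0 := by
  rw [specNorm, norm_eq_zero, EmbeddingLike.map_eq_zero_iff]

/-- **Hanson–Wright-type inequality for standard Gaussian quadratic forms.**
If `X ∼ N(0, I_n)`, then `E[XᵀAX] = Tr(A)` and, for all `t > 0`,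
`P(XᵀAX − Tr(A) ≥ t) ≤ exp(−min(t²/(8‖A‖_F²), t/(8‖A‖₂)))`. -/
theorem hanson_wright_standard_gaussian
    {Ω : Type*} [MeasurableSpace Ω] (Pr : Measure Ω) [IsProbabilityMeasure Pr]
    (n : ℕ) (X : Ω → Fin n → ℝ) (hXmeas : Measurable X)
    (hlaw : IsGaussianLaw (Pr.map X) 0 (1 : Matrix (Fin n) (Fin n) ℝ))
    (A : Matrix (Fin n) (Fin n) ℝ) :
    (∫ ω, X ω ⬝ᵥ A *ᵥ X ω ∂Pr = A.trace) ∧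
    ∀ t : ℝ, 0 < t →
      Pr {ω | t ≤ X ω ⬝ᵥ A *ᵥ X ω - A.trace}
        ≤ ENNReal.ofReal (Real.exp (-(min (t ^ 2 / (8 * frobNorm A ^ 2))
            (t / (8 * specNorm A))))) := by
  obtain ⟨b, l, htr, hquad⟩ := exists_orthonormalBasis_dotProduct_mulVec_eq A
  have := Measure.isProbabilityMeasure_map (μ := Pr) hXmeas.aemeasurable
  set Y : Ω → Fin n → ℝ := fun ω ↦ (b.repr (WithLp.toLp 2 (X ω))).ofLp with hYdef
  have hY : Measurable Y := by fun_prop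
  have hYlaw : Pr.map Y = Measure.pi fun _ ↦ gaussianReal 0 1 := by
    rw [← hlaw.map_repr_eq_pi b, Measure.map_map (by fun_prop) hXmeas]
    rfl
  have hXY : ∀ ω, X ω ⬝ᵥ A *ᵥ X ω = ∑ i, l i * Y ω i ^ 2 := fun ω ↦ hquad (X ω)
  refine ⟨?_, fun t ht ↦ ?_⟩
  · have hint : ∀ i, Integrable (fun y : Fin n → ℝ ↦ l i * y i ^ 2)
        (Measure.pi fun _ ↦ gaussianReal 0 1) := fun i ↦
      ((measurePreserving_eval (fun _ : Fin n ↦ gaussianReal 0 1) i).integrable_comp_of_integrable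
        integrable_sq_gaussianReal).const_mul _
    have heval : ∀ i, ∫ y : Fin n → ℝ, y i ^ 2 ∂(Measure.pi fun _ ↦ gaussianReal 0 1) = 1 :=
      fun i ↦ by
        rw [integral_comp_eval (μ := fun _ : Fin n ↦ gaussianReal 0 1) (f := fun x : ℝ ↦ x ^ 2)
          (by fun_prop), integral_sq_gaussianReal]
    simp_rw [hXY]
    rw [← integral_map (f := fun y : Fin n → ℝ ↦ ∑ i, l i * y i ^ 2) hY.aemeasurable
      (by fun_prop : Continuous _).aestronglyMeasurable, hYlaw, integral_finsetSum _ fun i _ ↦ hint i]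
    simp_rw [integral_const_mul, heval, mul_one, htr]
  · have hset : {ω | t ≤ X ω ⬝ᵥ A *ᵥ X ω - A.trace}
        = Y ⁻¹' {y | t ≤ ∑ i, l i * (y i ^ 2 - 1)} := by
      ext ω
      simp [hXY, ← htr, mul_sub]
    by_cases hA : A = 0
    · refine prob_le_one.trans_eq ?_
      simp [frobNorm_eq_zero_iff.2 hA, specNorm_eq_zero_iff.2 hA]
    have hF : 0 < frobNorm A :=
      (Real.sqrt_nonneg _).lt_of_ne' (frobNorm_eq_zero_iff.not.2 hA)
    have hL : 0 < specNorm A := (norm_nonneg _).lt_of_ne' (specNorm_eq_zero_iff.not.2 hA)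
    rw [hset, ← Measure.map_apply hY (measurableSet_le (by fun_prop) (by fun_prop)), hYlaw,
      ← ofReal_measureReal]
    exact ENNReal.ofReal_le_ofReal (measureReal_pi_gaussianReal_le_sum_mul_sq_sub_one hF hL ht
      (sum_sq_le_frobNorm_sq_of_diagonal hquad) (abs_le_specNorm_of_diagonal hquad))
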